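/- (Impossibility of non-signaling privacy amplification.) Let 0 < ε ≤ 1/2, let n ≥ 1, and let P be the n-fold PR box with error ε. For every hash function f : {0,1}^n → {0,1} there exists a box partition w of P such that the non-uniformity of the key bit f(X) given w satisfies δ_w^f(0…0,0…0) ≥ (−1 + √(1 + 64ε²)) / (32ε). In particular, this lower bound is a positive constant depending only on ε and not on n, so the adversary's knowledge about the key bit cannot be made negligible by hashing. -/

import Mathlib

open Finset

/-- A box (non-signaling bipartite system). -/
structure IsBox {X Y U V : Type} [Fintype X] [Fintype Y]
    (P : X → Y → U → V → ℝ) : Prop where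
  nonneg : ∀ x y u v, 0 ≤ P x y u v
  norm : ∀ u v, ∑ x, ∑ y, P x y u v = 1
  nsA : ∀ y u u' v, ∑ x, P x y u v = ∑ x, P x y u' v
  nsB : ∀ x u v v', ∑ y, P x y u v = ∑ y, P x y u v'

/-- A box partition of a box `P`. -/
structure IsBoxPartition {X Y U V Z : Type} [Fintype X] [Fintype Y] [Fintype Z]
    (P : X → Y → U → V → ℝ) (p : Z → ℝ) (Q : Z → X → Y → U → V → ℝ) : Prop where
  weight_nonneg : ∀ z, 0 ≤ p z
  weight_sum : ∑ z, p z = 1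
  box : ∀ z, IsBox (Q z)
  decomp : ∀ x y u v, ∑ z, p z * Q z x y u v = P x y u v

/-- The unbiased PR box with error ε. -/
noncomputable def PRbox (ε : ℝ) (x y u v : Bool) : ℝ :=
  if xor x y = (u && v) then (1 - ε) / 2 else ε / 2

/-- The n-fold (product) PR box with error ε. -/
noncomputable def PRn (ε : ℝ) (n : ℕ) (x y u v : Fin n → Bool) : ℝ :=
  ∏ i, PRbox ε (x i) (y i) (u i) (v i)

/-- The non-uniformity of the key bit `f(X)` given a box partition `(p, Q)`,
at inputs `(u, v)`. -/
noncomputable def nonUniformity {n : ℕ} {Z : Type} [Fintype Z]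
    (p : Z → ℝ)
    (Q : Z → (Fin n → Bool) → (Fin n → Bool) → (Fin n → Bool) → (Fin n → Bool) → ℝ)
    (f : (Fin n → Bool) → Bool) (u v : Fin n → Bool) : ℝ :=
  (1/2) * ∑ z, p z *
    |(∑ x ∈ univ.filter (fun x => f x = false), ∑ y, Q z x y u v) -
      ∑ x ∈ univ.filter (fun x => f x = true), ∑ y, Q z x y u v|


noncomputable def kk (ε : ℝ) (a b : Bool) : ℝ := if a = b then 1 - ε else ε

noncomputable def KK (ε : ℝ) {n : ℕ} (x y : Fin n → Bool) : ℝ := ∏ i, kk ε (x i) (y i)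

noncomputable def TT (ε : ℝ) {n : ℕ} (h : (Fin n → Bool) → ℝ) (y : Fin n → Bool) : ℝ :=
  ∑ x, KK ε x y * h x

lemma sum_cons {n : ℕ} (F : (Fin (n+1) → Bool) → ℝ) :
    ∑ x, F x = ∑ x : Fin n → Bool, (F (Fin.cons false x) + F (Fin.cons true x)) := by
  rw [← (Fin.consEquiv (fun _ : Fin (n+1) => Bool)).sum_comp F, Fintype.sum_prod_type]
  simp [Fin.consEquiv, Finset.sum_add_distrib, add_comm]

lemma KK_cons (ε : ℝ) {n : ℕ} (a b : Bool) (x y : Fin n → Bool) :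
    KK ε (Fin.cons a x : Fin (n+1) → Bool) (Fin.cons b y) = kk ε a b * KK ε x y := by
  simp [KK, Fin.prod_univ_succ]

lemma TT_bound (ε : ℝ) (z0 : 0 ≤ ε) (z1 : ε ≤ 1) (n : ℕ) : ∀ h : (Fin n → Bool) → ℝ,
    (2:ℝ)^n * ∑ y, (TT ε h y)^2 ≤ (1-2*ε)^2 * 2^n * ∑ x, (h x)^2
      + (1 - (1-2*ε)^2) * (∑ x, h x)^2
      ∧ ∑ y, (TT ε h y)^2 ≤ ∑ x, (h x)^2 := by
  induction n with
  | zero =>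
    intro h
    simp [TT, KK, Fintype.sum_unique]
    nlinarith
  | succ n ih =>
    intro h
    set h0 : (Fin n → Bool) → ℝ := fun x => h (Fin.cons false x) with hh0
    set h1 : (Fin n → Bool) → ℝ := fun x => h (Fin.cons true x) with hh1
    have e1 : ∑ y, (TT ε h y)^2 = (1/2) * ∑ y, (TT ε (fun x => h0 x + h1 x) y)^2
        + (1/2) * (1-2*ε)^2 * ∑ y, (TT ε (fun x => h0 x - h1 x) y)^2 := by
      rw [sum_cons, Finset.mul_sum, Finset.mul_sum, ← Finset.sum_add_distrib]
      refine Finset.sum_congr rfl fun y _ => ?_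
      have a0 : TT ε h (Fin.cons false y) = (1-ε) * TT ε h0 y + ε * TT ε h1 y := by
        unfold TT
        rw [sum_cons, Finset.mul_sum, Finset.mul_sum, ← Finset.sum_add_distrib]
        refine Finset.sum_congr rfl fun x _ => ?_
        rw [KK_cons, KK_cons]; simp [kk, hh0, hh1]; ring
      have a1 : TT ε h (Fin.cons true y) = ε * TT ε h0 y + (1-ε) * TT ε h1 y := by
        unfold TT
        rw [sum_cons, Finset.mul_sum, Finset.mul_sum, ← Finset.sum_add_distrib]
        refine Finset.sum_congr rfl fun x _ => ?_
        rw [KK_cons, KK_cons]; simp [kk, hh0, hh1]; ring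
      have b0 : TT ε (fun x => h0 x + h1 x) y = TT ε h0 y + TT ε h1 y := by
        simp [TT, mul_add, Finset.sum_add_distrib]
      have b1 : TT ε (fun x => h0 x - h1 x) y = TT ε h0 y - TT ε h1 y := by
        simp [TT, mul_sub, Finset.sum_sub_distrib]
      rw [a0, a1, b0, b1]; ring
    have e2 : ∑ x, (h x)^2 = (1/2) * ∑ x, (h0 x + h1 x)^2 + (1/2) * ∑ x, (h0 x - h1 x)^2 := by
      rw [sum_cons, Finset.mul_sum, Finset.mul_sum, ← Finset.sum_add_distrib]
      refine Finset.sum_congr rfl fun y _ => ?_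
      simp only [hh0, hh1]; ring
    have e3 : ∑ x, h x = ∑ x, (h0 x + h1 x) := sum_cons h
    have i1 := ih (fun x => h0 x + h1 x)
    have i2 := ih (fun x => h0 x - h1 x)
    have hr : 0 ≤ (1-2*ε)^2 := sq_nonneg _
    have hN : (0:ℝ) < 2^n := by positivity
    have hr1 : (1-2*ε)^2 ≤ 1 := by nlinarith
    have j1 := i1.1
    have j2 := mul_le_mul_of_nonneg_left (mul_le_mul_of_nonneg_left i2.2 hN.le) hr
    have j3 : (1-2*ε)^2 * ∑ y, (TT ε (fun x => h0 x - h1 x) y)^2 ≤ ∑ x, (h0 x - h1 x)^2 :=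
      (mul_le_of_le_one_left (Finset.sum_nonneg fun _ _ => sq_nonneg _) hr1).trans i2.2
    have j4 := i1.2
    rw [e1, e2, e3, pow_succ]
    constructor
    · linarith
    · linarith

lemma KK_symm (ε : ℝ) {n : ℕ} (x y : Fin n → Bool) : KK ε x y = KK ε y x := by
  simp [KK, kk, eq_comm]

lemma sum_KK (ε : ℝ) {n : ℕ} (y : Fin n → Bool) : ∑ x, KK ε x y = 1 := by
  unfold KK
  rw [← Fintype.piFinset_univ, Finset.sum_prod_piFinset (s := univ) (g := fun i a => kk ε a (y i))]
  refine Finset.prod_eq_one fun i _ => ?_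
  cases h : y i <;> simp [kk]

lemma sum_PRn_x (ε : ℝ) {n : ℕ} (y u v : Fin n → Bool) : ∑ x, PRn ε n x y u v = (1/2)^n := by
  unfold PRn
  rw [← Fintype.piFinset_univ,
    Finset.sum_prod_piFinset (s := univ) (g := fun i a => PRbox ε a (y i) (u i) (v i))]
  have : ∀ i, ∑ a, PRbox ε a (y i) (u i) (v i) = 1/2 := by
    intro i
    cases h : y i <;> cases h' : u i <;> cases h'' : v i <;> simp [PRbox] <;> ring
  simp only [this]
  simp

lemma sum_PRn_y (ε : ℝ) {n : ℕ} (x u v : Fin n → Bool) : ∑ y, PRn ε n x y u v = (1/2)^n := by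
  unfold PRn
  rw [← Fintype.piFinset_univ,
    Finset.sum_prod_piFinset (s := univ) (g := fun i a => PRbox ε (x i) a (u i) (v i))]
  have : ∀ i, ∑ a, PRbox ε (x i) a (u i) (v i) = 1/2 := by
    intro i
    cases h : x i <;> cases h' : u i <;> cases h'' : v i <;> simp [PRbox] <;> ring
  simp only [this]
  simp

lemma PRn_zero (ε : ℝ) {n : ℕ} (x y v : Fin n → Bool) :
    PRn ε n x y (fun _ => false) v = (1/2)^n * KK ε x y := by
  unfold PRn KK
  have : ∀ i, PRbox ε (x i) (y i) false (v i) = (1/2) * kk ε (x i) (y i) := by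
    intro i
    cases x i <;> cases y i <;> simp [PRbox, kk] <;> ring
  simp only [this]
  rw [Finset.prod_mul_distrib]; simp

lemma PRn_nonneg {ε : ℝ} (h0 : 0 < ε) (h1 : ε ≤ 1/2) {n : ℕ} (x y u v : Fin n → Bool) :
    0 ≤ PRn ε n x y u v := by
  refine Finset.prod_nonneg fun i _ => ?_
  unfold PRbox; split_ifs <;> linarith

noncomputable def sg {n : ℕ} (f : (Fin n → Bool) → Bool) (x : Fin n → Bool) : ℝ :=
  if f x = false then 1 else -1

noncomputable def DD (ε : ℝ) {n : ℕ} (f : (Fin n → Bool) → Bool) (x y u v : Fin n → Bool) : ℝ :=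
  if u = (fun _ => false) then
    PRn ε n x y u v * ((sg f x - TT ε (sg f) y) / (1 + |TT ε (sg f) y|))
  else 0

lemma DD_abs {ε : ℝ} (h0 : 0 < ε) (h1 : ε ≤ 1/2) {n : ℕ} (f : (Fin n → Bool) → Bool)
    (x y u v : Fin n → Bool) : |DD ε f x y u v| ≤ PRn ε n x y u v := by
  have hP := PRn_nonneg h0 h1 x y u v
  unfold DD
  split_ifs
  · have hp : 0 < 1 + |TT ε (sg f) y| := by positivity
    rw [abs_mul, abs_of_nonneg hP, abs_div, abs_of_pos hp]
    apply mul_le_of_le_one_right hP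
    rw [div_le_one hp]
    refine (abs_sub _ _).trans ?_
    have : |sg f x| = 1 := by unfold sg; split_ifs <;> simp
    rw [this]
  · simpa using hP

lemma DD_sum_x (ε : ℝ) {n : ℕ} (f : (Fin n → Bool) → Bool)
    (y u v : Fin n → Bool) : ∑ x, DD ε f x y u v = 0 := by
  unfold DD
  split_ifs with h
  · subst h
    have : ∀ x, PRn ε n x y (fun _ => false) v
        * ((sg f x - TT ε (sg f) y) / (1 + |TT ε (sg f) y|))
        = ((1/2)^n / (1 + |TT ε (sg f) y|)) * (KK ε x y * sg f x - TT ε (sg f) y * KK ε x y) := by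
      intro x; rw [PRn_zero]; ring
    simp only [this]
    rw [← Finset.mul_sum, Finset.sum_sub_distrib, ← Finset.mul_sum, sum_KK]
    simp [TT]
  · simp

lemma DD_v (ε : ℝ) {n : ℕ} (f : (Fin n → Bool) → Bool)
    (x y u v v' : Fin n → Bool) : DD ε f x y u v = DD ε f x y u v' := by
  unfold DD
  split_ifs with h
  · subst h; rw [PRn_zero, PRn_zero]
  · rfl

lemma box_of {ε : ℝ} (h0 : 0 < ε) (h1 : ε ≤ 1/2) {n : ℕ} (f : (Fin n → Bool) → Bool)
    (c : ℝ) (hc : |c| = 1) :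
    IsBox (fun x y u v => PRn ε n x y u v + c * DD ε f x y u v) where
  nonneg x y u v := by
    have h := DD_abs h0 h1 f x y u v
    have : |c * DD ε f x y u v| ≤ PRn ε n x y u v := by rw [abs_mul, hc, one_mul]; exact h
    linarith [neg_le_of_abs_le this]
  norm u v := by
    rw [Finset.sum_comm]
    simp only [Finset.sum_add_distrib, ← Finset.mul_sum, DD_sum_x, sum_PRn_x]
    simp
  nsA y u u' v := by
    simp only [Finset.sum_add_distrib, ← Finset.mul_sum, DD_sum_x, sum_PRn_x]
  nsB x u v v' := by
    simp only [Finset.sum_add_distrib, ← Finset.mul_sum, sum_PRn_y, DD_v ε f x _ u v v']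

lemma diff_eq {n : ℕ} (f : (Fin n → Bool) → Bool) (F : (Fin n → Bool) → ℝ) :
    (∑ x ∈ univ.filter (fun x => f x = false), F x) -
      ∑ x ∈ univ.filter (fun x => f x = true), F x = ∑ x, sg f x * F x := by
  rw [Finset.sum_filter, Finset.sum_filter, ← Finset.sum_sub_distrib]
  refine Finset.sum_congr rfl fun x _ => ?_
  unfold sg
  cases f x <;> simp

lemma sg_sq {n : ℕ} (f : (Fin n → Bool) → Bool) (x) : sg f x * sg f x = 1 := by
  unfold sg; split_ifs <;> simp

lemma DD_gain (ε : ℝ) {n : ℕ} (f : (Fin n → Bool) → Bool) (v : Fin n → Bool) :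
    ∑ x, sg f x * ∑ y, DD ε f x y (fun _ => false) v
      = (1/2)^n * ∑ y, (1 - |TT ε (sg f) y|) := by
  simp only [Finset.mul_sum]
  rw [Finset.sum_comm]
  refine Finset.sum_congr rfl fun y _ => ?_
  have hp : 0 < 1 + |TT ε (sg f) y| := by positivity
  have : ∀ x, sg f x * DD ε f x y (fun _ => false) v
      = ((1/2)^n / (1 + |TT ε (sg f) y|)) * (KK ε x y - TT ε (sg f) y * (KK ε x y * sg f x)) := by
    intro x
    simp only [DD, if_true, PRn_zero]
    linear_combination ((1/2)^n / (1 + |TT ε (sg f) y|)) * KK ε x y * sg_sq f x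
  simp only [this]
  rw [← Finset.mul_sum, Finset.sum_sub_distrib, ← Finset.mul_sum, sum_KK]
  change _ * (1 - TT ε (sg f) y * TT ε (sg f) y) = _
  field_simp
  linear_combination (sq_abs (TT ε (sg f) y))

lemma gfacts (ε : ℝ) (h0 : 0 < ε) (h1 : ε ≤ 1/2) :
    ∃ g : ℝ, g = (-1 + Real.sqrt (1 + 64 * ε^2)) / (32 * ε) ∧ 0 < g ∧ g < 1/5 ∧
      16 * ε * g^2 + g = ε := by
  refine ⟨_, rfl, ?_⟩
  set g := (-1 + Real.sqrt (1 + 64 * ε^2)) / (32 * ε) with hg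
  have hs : Real.sqrt (1 + 64 * ε^2) = 32 * ε * g + 1 := by rw [hg]; field_simp; ring
  have h2 := Real.sq_sqrt (show 0 ≤ 1 + 64 * ε^2 by positivity)
  rw [hs] at h2
  have heq : 16 * ε * g^2 + g = ε := by
    have : 64 * ε * (16 * ε * g^2 + g - ε) = 0 := by linarith
    have := (mul_eq_zero.mp this).resolve_left (by positivity)
    linarith
  have hpos : 0 < g := by
    apply div_pos _ (by positivity)
    have : 1 < Real.sqrt (1 + 64 * ε^2) := by
      rw [Real.lt_sqrt (by norm_num)]; nlinarith
    linarith
  refine ⟨hpos, ?_, heq⟩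
  by_contra hcon
  push Not at hcon
  nlinarith [mul_le_mul hcon hcon (by norm_num) hpos.le]

lemma key_ineq (ε g : ℝ) (h0 : 0 < ε) (hg : 0 < g) (hg5 : g < 1/5)
    (heq : 16 * ε * g^2 + g = ε) :
    (1-2*ε)^2 + (1 - (1-2*ε)^2) * (2*g)^2 ≤ (1-2*g)^2 := by
  have hq : 0 < 1 - 16*g^2 := by nlinarith
  have he : ε = g / (1 - 16*g^2) := by rw [eq_div_iff hq.ne']; linarith
  have hpoly : 0 ≤ 12 - 28*g - 192*g^2 + 256*g^3 := by
    nlinarith [mul_pos hg hg, pow_pos hg 3]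
  have : (1-2*g)^2 - ((1-2*ε)^2 + (1 - (1-2*ε)^2) * (2*g)^2)
      = 4 * g^3 * (12 - 28*g - 192*g^2 + 256*g^3) / (1 - 16*g^2)^2 := by
    have hne := hq.ne'
    rw [he, eq_div_iff (pow_ne_zero 2 hne)]
    have hi : (1 - 16*g^2) * (g / (1 - 16*g^2)) = g := mul_div_cancel₀ g hne
    generalize g / (1 - 16*g^2) = e at hi
    linear_combination (4 * (1-4*g^2) * (1-16*g^2) - 4*(1-4*g^2)*((1-16*g^2)*e+g)) * hi
  have h3 : 0 ≤ 4 * g^3 * (12 - 28*g - 192*g^2 + 256*g^3) / (1 - 16*g^2)^2 := by positivity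
  linarith

/-- Impossibility of non-signaling privacy amplification: for every hash function
`f : {0,1}ⁿ → {0,1}` there exists a box partition `w` of the n-fold PR box with error ε
such that the non-uniformity of the key bit `f(X)` given `w` is at least
`(-1 + √(1 + 64ε²)) / (32ε)` — a positive constant depending only on ε, not on `n`. -/
theorem impossibility_of_ns_privacy_amplification (ε : ℝ) (hε0 : 0 < ε) (hε1 : ε ≤ 1/2)
    (n : ℕ) (hn : 1 ≤ n) (f : (Fin n → Bool) → Bool) :
    ∃ (Z : Type) (iZ : Fintype Z) (p : Z → ℝ)
      (Q : Z → (Fin n → Bool) → (Fin n → Bool) → (Fin n → Bool) → (Fin n → Bool) → ℝ),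
      @IsBoxPartition _ _ _ _ Z _ _ iZ (PRn ε n) p Q ∧
      (-1 + Real.sqrt (1 + 64 * ε^2)) / (32 * ε)
        ≤ @nonUniformity n Z iZ p Q f (fun _ => false) (fun _ => false) := by
  obtain ⟨g, hgdef, hg0, hg5, heq⟩ := gfacts ε hε0 hε1
  rw [← hgdef]
  refine ⟨Bool, inferInstance, fun _ => 1/2,
    fun z x y u v => PRn ε n x y u v + (if z then 1 else -1) * DD ε f x y u v, ?_, ?_⟩
  · constructor
    · intro z; norm_num
    · simp
    · intro z
      apply box_of hε0 hε1
      cases z <;> simp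
    · intro x y u v
      simp
      ring
  · unfold nonUniformity
    simp only [diff_eq]
    have hsplit : ∀ c : ℝ, ∑ x, sg f x * ∑ y, (PRn ε n x y (fun _ => false) (fun _ => false)
        + c * DD ε f x y (fun _ => false) (fun _ => false))
        = ∑ x, sg f x * (1/2:ℝ)^n + c * ((1/2:ℝ)^n * ∑ y, (1 - |TT ε (sg f) y|)) := by
      intro c
      rw [← DD_gain ε f (fun _ => false), Finset.mul_sum, ← Finset.sum_add_distrib]
      refine Finset.sum_congr rfl fun x _ => ?_
      rw [Finset.sum_add_distrib, ← Finset.mul_sum, sum_PRn_y]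
      ring
    simp only [hsplit, Fintype.sum_bool]
    set A := ∑ x, sg f x * (1/2:ℝ)^n with hA
    set B := (1/2:ℝ)^n * ∑ y, (1 - |TT ε (sg f) y|) with hB
    have main : 2 * g ≤ |A| ∨ 2 * g ≤ B := by
      by_contra hcon
      push Not at hcon
      obtain ⟨hA2, hB2⟩ := hcon
      have hT := (TT_bound ε hε0.le (by linarith) n (sg f)).1
      have hc : ∑ x, (sg f x)^2 = (2:ℝ)^n := by
        simp [pow_two, sg_sq]
      have hAS : A = (∑ x, sg f x) * (1/2)^n := by rw [hA, Finset.sum_mul]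
      have hN : (0:ℝ) < 2^n := by positivity
      have hNN : (2:ℝ)^n * (1/2)^n = 1 := by rw [← mul_pow]; norm_num
      have hS : ∑ x, sg f x = A * 2^n := by rw [hAS]; linear_combination -(∑ x, sg f x) * hNN
      rw [hc, hS] at hT
      have hT2 : ∑ y, (TT ε (sg f) y)^2 ≤ 2^n * (1-2*g)^2 := by
        have hk := key_ineq ε g hε0 hg0 hg5 heq
        have hAA : A^2 ≤ (2*g)^2 := by rw [← sq_abs A]; gcongr
        have hr : 0 ≤ 1 - (1-2*ε)^2 := by nlinarith
        have h5 : (1-2*ε)^2 + (1 - (1-2*ε)^2) * A^2 ≤ (1-2*g)^2 := by nlinarith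
        have h6 : (2:ℝ)^n * ∑ y, (TT ε (sg f) y)^2 ≤ 2^n * (2^n * (1-2*g)^2) := by
          refine hT.trans ?_
          have := mul_le_mul_of_nonneg_left h5 (mul_pos hN hN).le
          linarith
        exact le_of_mul_le_mul_left h6 hN
      have hr : 0 < 1 - 2*g := by linarith
      have hab : (2 * (1-2*g)) * ∑ y, |TT ε (sg f) y|
          ≤ ∑ y, (TT ε (sg f) y)^2 + 2^n * (1-2*g)^2 := by
        have : (2:ℝ)^n * (1-2*g)^2 = ∑ y : Fin n → Bool, (1-2*g)^2 := by simp
        rw [this, Finset.mul_sum, ← Finset.sum_add_distrib]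
        refine Finset.sum_le_sum fun y _ => ?_
        rw [← sq_abs (TT ε (sg f) y)]
        nlinarith [sq_nonneg (|TT ε (sg f) y| - (1-2*g))]
      have hab2 : ∑ y, |TT ε (sg f) y| ≤ 2^n * (1-2*g) := by
        have : (2 * (1-2*g)) * ∑ y, |TT ε (sg f) y| ≤ (2 * (1-2*g)) * (2^n * (1-2*g)) := by
          linarith
        exact le_of_mul_le_mul_left this (by linarith)
      have hBe : B * 2^n = 2^n - ∑ y, |TT ε (sg f) y| := by
        have : ∑ y, (1 - |TT ε (sg f) y|) = 2^n - ∑ y, |TT ε (sg f) y| := by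
          rw [Finset.sum_sub_distrib]; simp
        rw [hB, this]
        linear_combination (2^n - ∑ y, |TT ε (sg f) y|) * hNN
      have := mul_lt_mul_of_pos_right hB2 hN
      linarith
    simp only [if_true, Bool.false_eq_true, if_false]
    have t1 := abs_add_le (A + 1 * B) (A + -1 * B)
    have t2 := abs_sub (A + 1 * B) (A + -1 * B)
    have t3 : (A + 1 * B) + (A + -1 * B) = 2 * A := by ring
    have t4 : (A + 1 * B) - (A + -1 * B) = 2 * B := by ring
    rw [t3, abs_mul, abs_two] at t1
    rw [t4, abs_mul, abs_two] at t2
    have := le_abs_self B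
    rcases main with h | h <;> linarith
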